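/- Let p, q be positive reals and let g : ℝ → ℝ be a nonnegative measurable function. Then ∫₀^∞ ∫₀^∞ (y²/(x+y)²) · g(xy/(x+y)) · exp(-p·x - q·y) dx dy = 2·(√p/√q) · ∫₀^∞ g(t) · t · exp(-(p+q)·t) · K₁(2·√p·√q·t) dt. -/

import Mathlib

open MeasureTheory Real

/-- Modified Bessel function of the second kind, via its integral representation
`K_ν(z) = ∫₀^∞ exp(-z cosh u) cosh (ν u) du`. -/
noncomputable def besselK (ν : ℝ) (z : ℝ) : ℝ :=
  ∫ u in Set.Ioi (0:ℝ), Real.exp (-z * Real.cosh u) * Real.cosh (ν * u)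

lemma aux_scale (c : ℝ) (hc : 0 < c) (f : ℝ → ENNReal) :
    ∫⁻ x in Set.Ioi (0:ℝ), f x = ∫⁻ x in Set.Ioi (0:ℝ), ENNReal.ofReal c * f (c * x) := by
  have him : (fun x : ℝ => c * x) '' Set.Ioi (0:ℝ) = Set.Ioi 0 := by
    ext y
    constructor
    · rintro ⟨x, hx, rfl⟩
      exact mul_pos hc hx
    · intro hy
      refine ⟨y / c, div_pos hy hc, ?_⟩
      field_simp
  have h := lintegral_image_eq_lintegral_abs_deriv_mul (s := Set.Ioi (0:ℝ))
    (f := fun x : ℝ => c * x) (f' := fun _ => c) measurableSet_Ioi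
    (fun x _ => by simpa using ((hasDerivAt_id x).const_mul c).hasDerivWithinAt)
    (fun a _ b _ hab => mul_left_cancel₀ hc.ne' hab) f
  rw [him, abs_of_pos hc] at h
  exact h

lemma aux_exp (c : ℝ) (hc : 0 < c) (f : ℝ → ENNReal) :
    ∫⁻ x in Set.Ioi (0:ℝ), f x = ∫⁻ u : ℝ, ENNReal.ofReal (c * exp u) * f (c * exp u) := by
  have him : (fun x : ℝ => c * exp x) '' Set.univ = Set.Ioi 0 := by
    ext y
    constructor
    · rintro ⟨x, hx, rfl⟩
      exact mul_pos hc (exp_pos x)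
    · intro hy
      refine ⟨log (y / c), trivial, ?_⟩
      simp only
      rw [exp_log (div_pos hy hc)]
      field_simp
  have h := lintegral_image_eq_lintegral_abs_deriv_mul (s := Set.univ)
    (f := fun x : ℝ => c * exp x) (f' := fun x => c * exp x) MeasurableSet.univ
    (fun x _ => ((Real.hasDerivAt_exp x).const_mul c).hasDerivWithinAt)
    (fun a _ b _ hab => exp_injective (mul_left_cancel₀ hc.ne' hab)) f
  rw [him, Measure.restrict_univ] at h
  rw [h]
  refine lintegral_congr fun u => ?_
  rw [abs_of_pos (by positivity)]

lemma aux_integrable (z : ℝ) (hz : 0 < z) :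
    IntegrableOn (fun u => exp (-z * cosh u) * cosh u) (Set.Ioi (0:ℝ)) := by
  have h1 : IntegrableOn (fun u => exp (-z * sinh u) * cosh u) (Set.Ioi (0:ℝ)) := by
    refine integrableOn_Ioi_deriv_of_nonneg (g := fun u => - exp (-z * sinh u) / z) (l := 0)
      (Continuous.continuousWithinAt (by fun_prop)) (fun x _ => ?_) (fun x _ => by positivity) ?_
    · have := ((((Real.hasDerivAt_sinh x).const_mul (-z)).exp).neg).div_const z
      have h5 : -(exp (-z * sinh x) * (-z * cosh x)) / z = exp (-z * sinh x) * cosh x := by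
        field_simp
      rw [h5] at this
      exact this
    · have h2 : Filter.Tendsto (fun u => z * sinh u) Filter.atTop Filter.atTop := by
        apply Filter.Tendsto.const_mul_atTop hz
        refine Filter.tendsto_atTop_mono' _ ?_ Filter.tendsto_id
        filter_upwards [Filter.eventually_ge_atTop 0] with x hx
        exact self_le_sinh_iff.2 hx
      have h3 := ((tendsto_exp_neg_atTop_nhds_zero.comp h2).neg).div_const z
      simpa [Function.comp_def] using h3
  refine Integrable.mono' h1 (Continuous.aestronglyMeasurable (by fun_prop)) ?_
  refine Filter.Eventually.of_forall fun u => ?_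
  have hc := cosh_pos u
  rw [norm_of_nonneg (by positivity)]
  have := (sinh_lt_cosh u).le
  refine mul_le_mul_of_nonneg_right (exp_le_exp.2 ?_) hc.le
  nlinarith

lemma aux_bessel (z : ℝ) (hz : 0 < z) :
    ∫⁻ u : ℝ, ENNReal.ofReal (exp u * exp (-z * cosh u))
      = ENNReal.ofReal (2 * besselK 1 z) := by
  have hm : Measurable fun u : ℝ => ENNReal.ofReal (exp u * exp (-z * cosh u)) :=
    (Continuous.measurable (by fun_prop)).ennreal_ofReal
  have hneg : ∫⁻ u in Set.Iic (0:ℝ), ENNReal.ofReal (exp u * exp (-z * cosh u))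
      = ∫⁻ u in Set.Ioi (0:ℝ), ENNReal.ofReal (exp (-u) * exp (-z * cosh u)) := by
    have h := lintegral_image_eq_lintegral_abs_deriv_mul (s := Set.Ici (0:ℝ))
      (f := fun x : ℝ => -x) (f' := fun x => -1) measurableSet_Ici
      (fun x _ => (hasDerivAt_neg x).hasDerivWithinAt)
      (fun a _ b _ hab => neg_injective hab)
      (fun u : ℝ => ENNReal.ofReal (exp u * exp (-z * cosh u)))
    have him : (fun x : ℝ => -x) '' Set.Ici 0 = Set.Iic 0 := by simp
    rw [him] at h
    rw [h, setLIntegral_congr Ioi_ae_eq_Ici.symm]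
    simp
  rw [← lintegral_add_compl _ (measurableSet_Iic (a := (0:ℝ))), Set.compl_Iic, hneg,
    ← lintegral_add_right _ hm]
  unfold besselK
  rw [← integral_const_mul, ofReal_integral_eq_lintegral_ofReal]
  · refine lintegral_congr fun u => ?_
    rw [← ENNReal.ofReal_add (by positivity) (by positivity)]
    congr 1
    rw [one_mul]
    nth_rw 4 [cosh_eq]
    ring
  · simpa using (aux_integrable z hz).const_mul 2
  · refine Filter.Eventually.of_forall fun u => ?_
    have := cosh_pos (1 * u)
    simp only [Pi.zero_apply]
    positivity

lemma aux_inner (p q t : ℝ) (hp : 0 < p) (hq : 0 < q) (ht : 0 < t) :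
    ∫⁻ r in Set.Ioi (0:ℝ), ENNReal.ofReal (exp (-t * (p / r + q * r)))
      = ENNReal.ofReal (2 * (√p / √q) * besselK 1 (2 * √p * √q * t)) := by
  have hp' := sqrt_pos.2 hp
  have hq' := sqrt_pos.2 hq
  rw [aux_exp (√p / √q) (by positivity)]
  have : ∀ u : ℝ, ENNReal.ofReal (√p / √q * exp u) *
      ENNReal.ofReal (exp (-t * (p / (√p / √q * exp u) + q * (√p / √q * exp u))))
      = ENNReal.ofReal (√p / √q) *
        ENNReal.ofReal (exp u * exp (-(2 * √p * √q * t) * cosh u)) := by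
    intro u
    rw [← ENNReal.ofReal_mul (by positivity), ← ENNReal.ofReal_mul (by positivity), mul_assoc]
    congr 4
    rw [cosh_eq, exp_neg]
    have h1 : p / (√p / √q * exp u) = √p * √q * (exp u)⁻¹ := by
      field_simp
      exact (sq_sqrt hp.le).symm
    have h2 : q * (√p / √q * exp u) = √p * √q * exp u := by
      field_simp
      exact (sq_sqrt hq.le).symm
    rw [h1, h2]
    ring
  simp_rw [this]
  rw [lintegral_const_mul' _ _ ENNReal.ofReal_ne_top, aux_bessel _ (by positivity),
    ← ENNReal.ofReal_mul (by positivity)]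
  congr 1
  ring

theorem stmt_7 (p q : ℝ) (hp : 0 < p) (hq : 0 < q) (g : ℝ → ℝ)
    (hg : Measurable g) (hg0 : ∀ t, 0 ≤ g t) :
    (∫⁻ x in Set.Ioi (0:ℝ), ∫⁻ y in Set.Ioi (0:ℝ),
        ENNReal.ofReal ((y ^ 2 / (x + y) ^ 2) * g (x * y / (x + y)) *
          Real.exp (-p * x - q * y)))
    = ENNReal.ofReal (2 * (Real.sqrt p / Real.sqrt q)) *
      ∫⁻ t in Set.Ioi (0:ℝ),
        ENNReal.ofReal (g t * t * Real.exp (-(p + q) * t) *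
          besselK 1 (2 * Real.sqrt p * Real.sqrt q * t)) := by
  have e1 : (∫⁻ x in Set.Ioi (0:ℝ), ∫⁻ y in Set.Ioi (0:ℝ),
        ENNReal.ofReal ((y ^ 2 / (x + y) ^ 2) * g (x * y / (x + y)) *
          Real.exp (-p * x - q * y)))
      = ∫⁻ x in Set.Ioi (0:ℝ), ∫⁻ r in Set.Ioi (0:ℝ), ENNReal.ofReal x *
        ENNReal.ofReal (((x * r) ^ 2 / (x + x * r) ^ 2) * g (x * (x * r) / (x + x * r)) *
          Real.exp (-p * x - q * (x * r))) := by
    refine setLIntegral_congr_fun measurableSet_Ioi fun x hx => ?_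
    exact aux_scale x hx _
  rw [e1, lintegral_lintegral_swap]
  swap
  · apply Measurable.aemeasurable
    unfold Function.uncurry
    fun_prop
  have e2 : (∫⁻ r in Set.Ioi (0:ℝ), ∫⁻ x in Set.Ioi (0:ℝ), ENNReal.ofReal x *
        ENNReal.ofReal (((x * r) ^ 2 / (x + x * r) ^ 2) * g (x * (x * r) / (x + x * r)) *
          Real.exp (-p * x - q * (x * r))))
      = ∫⁻ r in Set.Ioi (0:ℝ), ∫⁻ t in Set.Ioi (0:ℝ),
        ENNReal.ofReal (g t * t * Real.exp (-(p + q) * t)) *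
          ENNReal.ofReal (exp (-t * (p / r + q * r))) := by
    refine setLIntegral_congr_fun measurableSet_Ioi fun r hr => ?_
    have hr : 0 < r := hr
    rw [aux_scale ((1 + r) / r) (by positivity)]
    refine setLIntegral_congr_fun measurableSet_Ioi fun t ht => ?_
    have ht : 0 < t := ht
    have hgt := hg0 t
    have a1 : (1 + r) / r * t * ((1 + r) / r * t * r) / ((1 + r) / r * t + (1 + r) / r * t * r)
        = t := by
      field_simp
    rw [a1, ← ENNReal.ofReal_mul (by positivity), ← ENNReal.ofReal_mul (by positivity),
      ← ENNReal.ofReal_mul (by positivity)]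
    congr 1
    have a2 : exp (-p * ((1 + r) / r * t) - q * ((1 + r) / r * t * r))
        = exp (-(p + q) * t) * exp (-t * (p / r + q * r)) := by
      rw [← exp_add]
      congr 1
      field_simp
      ring
    rw [a2]
    field_simp
  rw [e2, lintegral_lintegral_swap]
  swap
  · apply Measurable.aemeasurable
    unfold Function.uncurry
    fun_prop
  rw [← lintegral_const_mul' _ _ ENNReal.ofReal_ne_top]
  refine setLIntegral_congr_fun measurableSet_Ioi fun t ht => ?_
  have ht : 0 < t := ht
  have hgt := hg0 t
  rw [lintegral_const_mul' _ _ ENNReal.ofReal_ne_top, aux_inner p q t hp hq ht,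
    ← ENNReal.ofReal_mul (by positivity), ← ENNReal.ofReal_mul (by positivity)]
  congr 1
  ring
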